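/- arXiv:0806.1125 — 2 statements merged into one kernel-verified Lean document; each statement's English description precedes it below -/
import Mathlib

section
/- Let 2 ≤ i ≤ n, let V be a positive word whose letters lie among a_1, …, a_{i−1}, and for each 1 ≤ j ≤ i−1 let V_j be a positive word whose letters lie among a_1, …, a_j. Then in the positive braid monoid B⁺_{n+1} one has a_i V Λ_1 V_1 Λ_2 V_2 ⋯ Λ_{i−1} V_{i−1} Λ_i = Δ_i a_1 V^{Δ_i} V_1^{(i−1)} V_2^{(i−2)} ⋯ V_{i−1}^{(1)}. -/
/-- Defining relations of the braid monoid/group on `n` strands' generators `Fin n`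
(generator `i : Fin n` represents the Artin generator `a_{i+1}`):
braid relations `a_{i+1} a_i a_{i+1} = a_i a_{i+1} a_i` and
commutation `a_k a_s = a_s a_k` for `k - s ≥ 2`. -/
def braidRels (n : ℕ) : FreeMonoid (Fin n) → FreeMonoid (Fin n) → Prop := fun x y =>
  (∃ i j : Fin n, (i : ℕ) + 1 = j ∧
      x = .of j * .of i * .of j ∧ y = .of i * .of j * .of i) ∨
  (∃ i j : Fin n, (i : ℕ) + 2 ≤ j ∧
      x = .of j * .of i ∧ y = .of i * .of j)

/-- The positive braid monoid `B⁺_{n+1}`. -/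
def BraidMonoid (n : ℕ) : Type := PresentedMonoid (braidRels n)

instance (n : ℕ) : Monoid (BraidMonoid n) :=
  inferInstanceAs (Monoid (PresentedMonoid (braidRels n)))

/-- Relators of the braid group `B_{n+1}` on generators `Fin n`. -/
def braidRelators (n : ℕ) : Set (FreeGroup (Fin n)) :=
  {r | (∃ i j : Fin n, (i : ℕ) + 1 = j ∧
          r = .of j * .of i * .of j * (.of i * .of j * .of i)⁻¹) ∨
       (∃ i j : Fin n, (i : ℕ) + 2 ≤ j ∧
          r = .of j * .of i * (.of i * .of j)⁻¹)}

/-- The braid group `B_{n+1}`. -/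
def BraidGroup (n : ℕ) : Type := PresentedGroup (braidRelators n)

instance (n : ℕ) : Group (BraidGroup n) :=
  inferInstanceAs (Group (PresentedGroup (braidRelators n)))

namespace Braid

/-- The Artin generator `a_i` (`1 ≤ i ≤ n`) of the positive braid monoid;
junk value `1` outside this range. -/
def a (n i : ℕ) : BraidMonoid n :=
  if h : 1 ≤ i ∧ i ≤ n then PresentedMonoid.of (braidRels n) ⟨i - 1, by omega⟩ else 1

/-- The Artin generator `a_i` (`1 ≤ i ≤ n`) of the braid group; junk value `1` otherwise. -/
def b (n i : ℕ) : BraidGroup n :=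
  if h : 1 ≤ i ∧ i ≤ n then PresentedGroup.of (rels := braidRelators n) ⟨i - 1, by omega⟩ else 1

/-- The element of `B⁺_{n+1}` given by a positive word, i.e. a list of indices of
Artin generators. -/
def w (n : ℕ) (L : List ℕ) : BraidMonoid n := (L.map (a n)).prod

/-- The element of `B_{n+1}` given by a positive word. -/
def wG (n : ℕ) (L : List ℕ) : BraidGroup n := (L.map (b n)).prod

/-- `Λ_i = a_i a_{i-1} ⋯ a_1`. -/
def Lam (n i : ℕ) : BraidMonoid n := ((List.range i).reverse.map (fun m => a n (m + 1))).prod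

/-- `Λ_i^{(−)} = a_i a_{i-1} ⋯ a_2`  (`Λ_1^{(−)} = 1`). -/
def LamM (n i : ℕ) : BraidMonoid n :=
  ((List.range (i - 1)).reverse.map (fun m => a n (m + 2))).prod

/-- `Λ_i^{(−−)} = a_i a_{i-1} ⋯ a_3`  (`Λ_2^{(−−)} = 1`). -/
def LamMM (n i : ℕ) : BraidMonoid n :=
  ((List.range (i - 2)).reverse.map (fun m => a n (m + 3))).prod

/-- `Δ_i = Λ_1 Λ_2 ⋯ Λ_i`. -/
def DeltaI (n i : ℕ) : BraidMonoid n := ((List.range i).map (fun m => Lam n (m + 1))).prod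

/-- The Garside element `Δ = Λ_1 Λ_2 ⋯ Λ_n`. -/
def Delta (n : ℕ) : BraidMonoid n := DeltaI n n

/-- `Λ_i` in the braid group. -/
def LamG (n i : ℕ) : BraidGroup n := ((List.range i).reverse.map (fun m => b n (m + 1))).prod

/-- `Δ_i = Λ_1 Λ_2 ⋯ Λ_i` in the braid group. -/
def DeltaIG (n i : ℕ) : BraidGroup n := ((List.range i).map (fun m => LamG n (m + 1))).prod

/-- The descending run `a_{ij} = a_i a_{i-1} ⋯ a_j` (`j ≤ i`), with `a_{i,i+1} = 1`. -/
def run (n i j : ℕ) : BraidMonoid n :=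
  ((List.range (i + 1 - j)).reverse.map (fun m => a n (m + j))).prod

end Braid

namespace Braid

theorem a_eq_of {n : ℕ} (j : Fin n) : a n (j + 1) = PresentedMonoid.of (braidRels n) j :=
  dif_pos ⟨by omega, by omega⟩

theorem a_braid {n m : ℕ} (h1 : 1 ≤ m) (h2 : m + 1 ≤ n) :
    a n (m + 1) * a n m * a n (m + 1) = a n m * a n (m + 1) * a n m := by
  obtain ⟨k, rfl⟩ : ∃ k, m = k + 1 := ⟨m - 1, by omega⟩
  have hk := a_eq_of (⟨k, by omega⟩ : Fin n)
  have hk' := a_eq_of (⟨k + 1, by omega⟩ : Fin n)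
  simp only at hk hk'
  rw [hk, hk']
  exact PresentedMonoid.mk_eq_mk_of_rel (Or.inl ⟨_, _, rfl, rfl, rfl⟩)

theorem a_comm {n m k : ℕ} (h1 : 1 ≤ m) (h2 : m + 2 ≤ k) (h3 : k ≤ n) :
    a n k * a n m = a n m * a n k := by
  obtain ⟨m, rfl⟩ : ∃ l, m = l + 1 := ⟨m - 1, by omega⟩
  obtain ⟨k, rfl⟩ : ∃ l, k = l + 1 := ⟨k - 1, by omega⟩
  have hm := a_eq_of (⟨m, by omega⟩ : Fin n)
  have hk := a_eq_of (⟨k, by omega⟩ : Fin n)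
  simp only at hm hk
  rw [hm, hk]
  exact PresentedMonoid.mk_eq_mk_of_rel
    (Or.inr ⟨⟨m, by omega⟩, ⟨k, by omega⟩, by simp only; omega, rfl, rfl⟩)

theorem Lam_zero (n : ℕ) : Lam n 0 = 1 := rfl

theorem Lam_succ (n k : ℕ) : Lam n (k + 1) = a n (k + 1) * Lam n k := by
  simp [Lam, List.range_succ]

theorem DeltaI_succ (n k : ℕ) : DeltaI n (k + 1) = DeltaI n k * Lam n (k + 1) := by
  simp [DeltaI, List.range_succ]

theorem a_mul_Lam_comm {n k m : ℕ} (h : m + 2 ≤ k) (hk : k ≤ n) :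
    a n k * Lam n m = Lam n m * a n k := by
  induction m with
  | zero => simp [Lam_zero]
  | succ m ih =>
    rw [Lam_succ, ← mul_assoc, a_comm (by omega) h hk, mul_assoc, ih (by omega), mul_assoc]

theorem a_mul_DeltaI_comm {n k m : ℕ} (h : m + 2 ≤ k) (hk : k ≤ n) :
    a n k * DeltaI n m = DeltaI n m * a n k := by
  induction m with
  | zero => simp [DeltaI]
  | succ m ih =>
    rw [DeltaI_succ, ← mul_assoc, ih (by omega), mul_assoc, a_mul_Lam_comm h hk, mul_assoc]

theorem a_mul_Lam {n k m : ℕ} (h1 : 1 ≤ m) (h2 : m < k) (hk : k ≤ n) :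
    a n m * Lam n k = Lam n k * a n (m + 1) := by
  induction k, h2 using Nat.le_induction with
  | base =>
    obtain ⟨m, rfl⟩ : ∃ l, m = l + 1 := ⟨m - 1, by omega⟩
    rw [Lam_succ, Lam_succ n m]
    have := a_braid h1 hk
    have hc := a_mul_Lam_comm (n := n) (m := m) (k := m + 1 + 1) le_rfl hk
    simp only [mul_assoc] at *
    rw [← hc, ← mul_assoc, ← mul_assoc, mul_assoc _ (a n (m + 1 + 1)), ← this]
    simp only [mul_assoc]
  | succ k h ih =>
    rw [Lam_succ, ← mul_assoc, ← a_comm h1 (by omega) hk, mul_assoc, ih (by omega), mul_assoc]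

/-- Moving a word past `X` letter by letter. -/
theorem w_mul {n : ℕ} {X : BraidMonoid n} {f : ℕ → ℕ} {L : List ℕ}
    (h : ∀ m ∈ L, a n m * X = X * a n (f m)) : w n L * X = X * w n (L.map f) := by
  induction L with
  | nil => simp [w]
  | cons m L ih =>
    have h1 := ih fun x hx => h x (List.mem_cons_of_mem _ hx)
    have h2 := h m List.mem_cons_self
    simp only [w, List.map_cons, List.prod_cons] at *
    rw [mul_assoc, h1, ← mul_assoc, h2, mul_assoc]

theorem Lam_eq_w (n k : ℕ) : Lam n k = w n ((List.range k).reverse.map (· + 1)) := by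
  simp only [Lam, w, List.map_map]
  rfl

theorem w_shift_mul_a_one (n k : ℕ) :
    w n (((List.range k).reverse.map (· + 1)).map (· + 1)) * a n 1 = Lam n (k + 1) := by
  simp [w, Lam, List.range_succ_eq_map, Function.comp_def]

theorem Lam_mul_Lam {n k : ℕ} (hk : k + 1 ≤ n) :
    Lam n (k + 1) * Lam n (k + 1) = Lam n k * Lam n (k + 1) * a n 1 := by
  have h : Lam n k * Lam n (k + 1) =
      Lam n (k + 1) * w n (((List.range k).reverse.map (· + 1)).map (· + 1)) := by
    rw [Lam_eq_w n k]
    refine w_mul fun m hm => a_mul_Lam ?_ ?_ hk <;> simp at hm <;> omega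
  rw [h, mul_assoc, w_shift_mul_a_one]

theorem a_mul_DeltaI {n k m : ℕ} (h1 : 1 ≤ m) (h2 : m ≤ k) (hk : k ≤ n) :
    a n m * DeltaI n k = DeltaI n k * a n (k - m + 1) := by
  induction k with
  | zero => omega
  | succ k ih =>
    rcases h2.lt_or_eq with h | rfl
    · rw [DeltaI_succ, ← mul_assoc, ih (by omega) (by omega), mul_assoc,
        a_mul_Lam (by omega) (by omega) hk, mul_assoc, show k + 1 - m = k - m + 1 by omega]
    · rw [Nat.sub_self, zero_add]
      cases k with
      | zero => simp [DeltaI, Lam]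
      | succ k =>
        rw [DeltaI_succ, DeltaI_succ n k]
        have h := a_mul_DeltaI_comm (n := n) (m := k) (k := k + 1 + 1) le_rfl hk
        calc _ = a n (k + 1 + 1) * DeltaI n k * (Lam n (k + 1) * Lam n (k + 1 + 1)) := by
              simp only [mul_assoc]
          _ = DeltaI n k * (Lam n (k + 1 + 1) * Lam n (k + 1 + 1)) := by
              rw [h, Lam_succ n (k + 1)]
              simp only [mul_assoc]
          _ = _ := by
              rw [Lam_mul_Lam hk]
              simp only [mul_assoc]

/-- The product of shifted words `V_1^{(k)} V_2^{(k-1)} ⋯ V_k^{(1)}` absorbs one more shift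
when moved past `Λ_{k+2}`. -/
theorem prod_shift_mul_Lam {n l : ℕ} (k : ℕ) (hl : l + 2 ≤ n) (hkl : k ≤ l + 1)
    {Vs : ℕ → List ℕ} (hVs : ∀ t < k, ∀ m ∈ Vs (t + 1), 1 ≤ m ∧ m ≤ t + 1) :
    ((List.range k).map fun t => w n ((Vs (t + 1)).map (· + (l - t)))).prod * Lam n (l + 2) =
      Lam n (l + 2) *
        ((List.range k).map fun t => w n ((Vs (t + 1)).map (· + (l + 1 - t)))).prod := by
  induction k with
  | zero => simp
  | succ k ih =>
    have hw : w n ((Vs (k + 1)).map (· + (l - k))) * Lam n (l + 2) =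
        Lam n (l + 2) * w n ((Vs (k + 1)).map (· + (l + 1 - k))) := by
      rw [w_mul (f := (· + 1)), List.map_map]
      · congr 3
        funext m
        simp only [Function.comp]
        omega
      · intro m hm
        obtain ⟨x, hx, rfl⟩ := List.mem_map.1 hm
        have := hVs k (by omega) x hx
        exact a_mul_Lam (by omega) (by omega) hl
    rw [List.prod_range_succ, List.prod_range_succ, mul_assoc, hw, ← mul_assoc,
      ih (by omega) fun t ht => hVs t (by omega), mul_assoc]

theorem interleaved_prod_mul_Lam {n k : ℕ} (hk : k + 1 ≤ n) {Vs : ℕ → List ℕ}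
    (hVs : ∀ t < k, ∀ m ∈ Vs (t + 1), 1 ≤ m ∧ m ≤ t + 1) :
    ((List.range k).map fun t => Lam n (t + 1) * w n (Vs (t + 1))).prod * Lam n (k + 1) =
      DeltaI n (k + 1) *
        ((List.range k).map fun t => w n ((Vs (t + 1)).map (· + (k - t)))).prod := by
  induction k with
  | zero => simp [DeltaI]
  | succ k ih =>
    have h := prod_shift_mul_Lam (k + 1) hk le_rfl hVs
    have hlast : ((List.range (k + 1)).map fun t => w n ((Vs (t + 1)).map (· + (k - t)))).prod =
        ((List.range k).map fun t => w n ((Vs (t + 1)).map (· + (k - t)))).prod *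
          w n (Vs (k + 1)) := by
      rw [List.prod_range_succ]
      simp
    rw [List.prod_range_succ, ← mul_assoc, ih (by omega) fun t ht => hVs t (by omega),
      DeltaI_succ n (k + 1), mul_assoc (DeltaI n (k + 1)) (Lam n (k + 1 + 1)), ← h, hlast]
    simp only [mul_assoc]

end Braid

/-- For `2 ≤ i ≤ n`, a positive word `V` in the letters `a_1, …, a_{i−1}`, and
positive words `V_j` in the letters `a_1, …, a_j` (for `1 ≤ j ≤ i−1`), in the positive braid
monoid `B⁺_{n+1}` one has
`a_i V Λ_1 V_1 Λ_2 V_2 ⋯ Λ_{i−1} V_{i−1} Λ_i = Δ_i a_1 V^{Δ_i} V_1^{(i−1)} ⋯ V_{i−1}^{(1)}`. -/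
theorem a_mul_word_mul_interleaved_prod (n i : ℕ) (hi1 : 2 ≤ i) (hi2 : i ≤ n)
    (V : List ℕ) (hV : ∀ m ∈ V, 1 ≤ m ∧ m ≤ i - 1) (Vs : ℕ → List ℕ)
    (hVs : ∀ j, 1 ≤ j → j ≤ i - 1 → ∀ m ∈ Vs j, 1 ≤ m ∧ m ≤ j) :
    Braid.a n i * Braid.w n V *
        ((List.range (i - 1)).map (fun t => Braid.Lam n (t + 1) * Braid.w n (Vs (t + 1)))).prod *
        Braid.Lam n i
      = Braid.DeltaI n i * Braid.a n 1 * Braid.w n (V.map (fun m => i - m + 1)) *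
        ((List.range (i - 1)).map
            (fun t => Braid.w n ((Vs (t + 1)).map (· + (i - 1 - t))))).prod := by
  obtain ⟨k, rfl⟩ : ∃ k, i = k + 1 := ⟨i - 1, by omega⟩
  rw [Nat.add_sub_cancel] at *
  rw [mul_assoc, Braid.interleaved_prod_mul_Lam hi2 fun t ht => hVs (t + 1) (by omega) (by omega),
    ← mul_assoc, mul_assoc _ (Braid.w n V), Braid.w_mul fun m hm =>
      Braid.a_mul_DeltaI (hV m hm).1 ((hV m hm).2.trans (Nat.le_succ k)) hi2,
    ← mul_assoc, Braid.a_mul_DeltaI (by omega) le_rfl hi2, Nat.sub_self]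
end

section
/- Let 1 ≤ i ≤ n−1 and 1 ≤ j ≤ i+1, let V be a positive word whose letters lie among a_1, …, a_{i−1}, and let W be a positive word whose letters lie among a_j, …, a_i. Then in the positive braid monoid B⁺_{n+1} one has a_{i+1} a_i V W a_{i+1,j} = a_i a_{i+1} a_i V a_{ij} W'. (These are the relations (1) of the Gröbner–Shirshov basis of B_{n+1} in the Artin–Garside generators.) -/
namespace Braid

theorem a_eq_of_s16 (n : ℕ) {i : ℕ} (h : 1 ≤ i ∧ i ≤ n) :
    a n i = PresentedMonoid.of (braidRels n) ⟨i - 1, by omega⟩ :=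
  dif_pos h

theorem a_eq_one (n : ℕ) {i : ℕ} (h : ¬(1 ≤ i ∧ i ≤ n)) : a n i = 1 :=
  dif_neg h

theorem a_mul_a_of_add_two_le (n : ℕ) {s k : ℕ} (h : s + 2 ≤ k) :
    a n k * a n s = a n s * a n k := by
  by_cases hk : 1 ≤ k ∧ k ≤ n
  · by_cases hs : 1 ≤ s ∧ s ≤ n
    · rw [a_eq_of_s16 n hk, a_eq_of_s16 n hs]
      refine Quotient.sound (ConGen.Rel.of _ _ (Or.inr ⟨⟨s - 1, by omega⟩,
        ⟨k - 1, by omega⟩, ?_, rfl, rfl⟩))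
      change s - 1 + 2 ≤ k - 1
      omega
    · rw [a_eq_one n hs, mul_one, one_mul]
  · rw [a_eq_one n hk, mul_one, one_mul]

theorem a_braid_s16 (n : ℕ) {i : ℕ} (hi : 1 ≤ i) (hn : i + 1 ≤ n) :
    a n (i + 1) * a n i * a n (i + 1) = a n i * a n (i + 1) * a n i := by
  rw [a_eq_of_s16 n ⟨by omega, hn⟩, a_eq_of_s16 n (i := i) ⟨hi, by omega⟩]
  refine Quotient.sound (ConGen.Rel.of _ _ (Or.inl ⟨⟨i - 1, by omega⟩,
    ⟨i + 1 - 1, by omega⟩, ?_, rfl, rfl⟩))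
  change i - 1 + 1 = i + 1 - 1
  omega

theorem w_nil (n : ℕ) : w n [] = 1 := rfl

theorem w_cons (n m : ℕ) (L : List ℕ) : w n (m :: L) = a n m * w n L := by
  simp [w]

theorem run_succ (n : ℕ) {i j : ℕ} (h : j ≤ i + 1) :
    run n (i + 1) j = a n (i + 1) * run n i j := by
  have h1 : i + 1 + 1 - j = (i + 1 - j) + 1 := by omega
  have h2 : i + 1 - j + j = i + 1 := by omega
  simp [run, h1, h2, List.range_succ]

theorem a_commute_w (n : ℕ) {k : ℕ} {L : List ℕ} (h : ∀ m ∈ L, m + 2 ≤ k) :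
    Commute (a n k) (w n L) := by
  refine Commute.list_prod_right _ _ fun x hx => ?_
  obtain ⟨m, hm, rfl⟩ := List.mem_map.1 hx
  exact a_mul_a_of_add_two_le n (h m hm)

theorem a_commute_run (n : ℕ) {i j k : ℕ} (hj : j ≤ i + 1) (h : i + 2 ≤ k) :
    Commute (a n k) (run n i j) := by
  refine Commute.list_prod_right _ _ fun x hx => ?_
  obtain ⟨m, hm, rfl⟩ := List.mem_map.1 hx
  rw [List.mem_reverse, List.mem_range] at hm
  exact a_mul_a_of_add_two_le n (by omega)

theorem a_mul_run_succ (n : ℕ) {i j m : ℕ} (hj : 1 ≤ j) (hjm : j ≤ m) (hmi : m ≤ i)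
    (hn : i + 1 ≤ n) : a n m * run n (i + 1) j = run n (i + 1) j * a n (m + 1) := by
  induction i, hmi using Nat.le_induction with
  | base =>
    obtain ⟨k, rfl⟩ : ∃ k, m = k + 1 := ⟨m - 1, by omega⟩
    have hc := (a_commute_run n hjm (le_refl (k + 2))).eq
    have hb := a_braid_s16 n (show 1 ≤ k + 1 by omega) hn
    rw [run_succ n (by omega : j ≤ k + 1 + 1), run_succ n hjm]
    calc _ = a n (k + 1) * a n (k + 1 + 1) * a n (k + 1) * run n k j := by
          simp only [mul_assoc]
      _ = a n (k + 1 + 1) * a n (k + 1) * (a n (k + 1 + 1) * run n k j) := by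
          rw [← hb, mul_assoc]
      _ = _ := by rw [hc]; simp only [mul_assoc]
  | succ i hmi ih =>
    rw [run_succ n (by omega : j ≤ i + 1 + 1), ← mul_assoc,
      ← a_mul_a_of_add_two_le n (by omega : m + 2 ≤ i + 1 + 1), mul_assoc, ih (by omega),
      mul_assoc]

theorem w_mul_run_succ (n : ℕ) {i j : ℕ} (hj : 1 ≤ j) (hn : i + 1 ≤ n) {W : List ℕ}
    (hW : ∀ m ∈ W, j ≤ m ∧ m ≤ i) :
    w n W * run n (i + 1) j = run n (i + 1) j * w n (W.map (· + 1)) := by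
  induction W with
  | nil => simp [w_nil]
  | cons m W ih =>
    rw [List.forall_mem_cons] at hW
    rw [List.map_cons, w_cons, w_cons, mul_assoc, ih hW.2, ← mul_assoc,
      a_mul_run_succ n hj hW.1.1 hW.1.2 hn, mul_assoc]

end Braid

/-- For `1 ≤ i ≤ n−1`, `1 ≤ j ≤ i+1`, a positive word `V` in the letters
`a_1, …, a_{i−1}` and a positive word `W` in the letters `a_j, …, a_i`, in the positive braid
monoid `B⁺_{n+1}` one has `a_{i+1} a_i V W a_{i+1,j} = a_i a_{i+1} a_i V a_{ij} W'`
(the relations (1) of the Gröbner–Shirshov basis of `B_{n+1}` in the Artin–Garside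
generators). -/
theorem gs_relation_one (n i j : ℕ) (hi1 : 1 ≤ i) (hi2 : i ≤ n - 1)
    (hj1 : 1 ≤ j) (hj2 : j ≤ i + 1)
    (V : List ℕ) (hV : ∀ m ∈ V, 1 ≤ m ∧ m ≤ i - 1)
    (W : List ℕ) (hW : ∀ m ∈ W, j ≤ m ∧ m ≤ i) :
    Braid.a n (i + 1) * Braid.a n i * Braid.w n V * Braid.w n W * Braid.run n (i + 1) j
      = Braid.a n i * Braid.a n (i + 1) * Braid.a n i * Braid.w n V * Braid.run n i j
          * Braid.w n (W.map (· + 1)) := by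
  have hV' : Commute (Braid.a n (i + 1)) (Braid.w n V) :=
    Braid.a_commute_w n fun m hm => by have := hV m hm; omega
  rw [mul_assoc, Braid.w_mul_run_succ n hj1 (by omega) hW, Braid.run_succ n hj2,
    ← Braid.a_braid_s16 n hi1 (by omega)]
  simp only [mul_assoc]
  rw [← mul_assoc (Braid.w n V), ← hV'.eq, mul_assoc]
end
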